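/- Let d ≥ 2 be an integer and μ > 0. There exist constants C > 0 and z₀ > 0 such that for all z ≥ z₀, |P_FD'(z) − (2/d)·(d·z/μ)^(2/d)| ≤ C·z^(−2/d); that is, P_FD'(z) = (2/d)·(dz/μ)^(2/d) + O(z^(−2/d)) as z → ∞. -/

import Mathlib

open Set MeasureTheory Function

/-- The Fermi function of order `α`. -/
noncomputable def fermi (α z : ℝ) : ℝ :=
  ∫ x in Set.Ioi (0:ℝ), x ^ α / (1 + Real.exp (x - z))

/-- The Fermi--Dirac pressure. -/
noncomputable def fermiDiracPressure (d : ℕ) (μ : ℝ) (z : ℝ) : ℝ :=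
  (μ / d) * fermi ((d : ℝ) / 2)
    (Function.invFun (fermi ((d : ℝ) / 2 - 1)) (2 * z / μ))
open Filter Topology

noncomputable def fdKer (t : ℝ) : ℝ := Real.exp t / (1 + Real.exp t) ^ 2

noncomputable def fdM (b w : ℝ) : ℝ := ∫ x in Set.Ioi (0:ℝ), x ^ b * fdKer (x - w)

lemma fdKer_pos (t : ℝ) : 0 < fdKer t := by unfold fdKer; positivity

lemma fdKer_cont : Continuous fdKer := by
  unfold fdKer
  refine Continuous.div (by fun_prop) (by fun_prop) (fun x => by positivity)

lemma fdKer_neg (t : ℝ) : fdKer (-t) = fdKer t := by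
  unfold fdKer
  rw [Real.exp_neg]
  have := Real.exp_pos t
  field_simp
  ring

lemma fdKer_le (t : ℝ) : fdKer t ≤ Real.exp (-t) := by
  unfold fdKer
  rw [Real.exp_neg]
  have := Real.exp_pos t
  rw [div_le_iff₀ (by positivity), inv_mul_eq_div, le_div_iff₀ this]
  nlinarith

lemma fdKer_le_abs (t : ℝ) : fdKer t ≤ Real.exp (-|t|) := by
  rcases abs_cases t with ⟨h, _⟩ | ⟨h, _⟩ <;> rw [h]
  · exact fdKer_le t
  · rw [← fdKer_neg]; exact fdKer_le (-t)

lemma fdKer_hasDerivAt (t : ℝ) :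
    HasDerivAt (fun t => -(1 + Real.exp t)⁻¹) (fdKer t) t := by
  have h := (((Real.hasDerivAt_exp t).const_add 1).fun_inv (by positivity)).fun_neg
  have e : fdKer t = -(-Real.exp t / (1 + Real.exp t) ^ 2) := by unfold fdKer; ring
  rw [e]
  exact h

lemma fd_exp_int (c : ℝ) (hc : 0 ≤ c) :
    Integrable (fun t : ℝ => (2 + |t|) ^ c * Real.exp (-|t|)) := by
  have h1 : IntegrableOn (fun t : ℝ => (2 + t) ^ c * Real.exp (-t)) (Ioi 0) := by
    apply integrable_of_isBigO_exp_neg (b := 1/2) (by norm_num)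
    · apply ContinuousOn.mul _ (by fun_prop)
      apply ContinuousOn.rpow_const (by fun_prop)
      intro x hx
      right; exact hc
    · have h2 := ((isLittleO_rpow_exp_pos_mul_atTop c (b := 1/2) (by norm_num)).comp_tendsto
        (tendsto_atTop_add_const_left atTop (2:ℝ) tendsto_id)).isBigO
      have h3 := h2.mul (Asymptotics.isBigO_refl (fun t : ℝ => Real.exp (-t)) atTop)
      refine (h3.congr_left (fun t => rfl)).trans ?_
      refine Asymptotics.IsBigO.of_bound (Real.exp 1) ?_
      filter_upwards with t
      simp only [Function.comp, id]
      rw [Real.norm_of_nonneg (by positivity), Real.norm_of_nonneg (by positivity)]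
      rw [← Real.exp_add, ← Real.exp_add]
      apply Real.exp_le_exp.2
      linarith
  have h2 : IntegrableOn (fun t : ℝ => (2 + |t|) ^ c * Real.exp (-|t|)) (Ioi 0) := by
    refine h1.congr_fun (fun t ht => ?_) measurableSet_Ioi
    simp only [abs_of_pos (mem_Ioi.1 ht)]
  have h3 : IntegrableOn (fun t : ℝ => (2 + |t|) ^ c * Real.exp (-|t|)) (Iic 0) := by
    have := (integrableOn_Ici_iff_integrableOn_Ioi (by finiteness)).2 h2
    have h4 := this.comp_neg
    simpa using h4
  rw [← integrableOn_univ, ← Set.Iic_union_Ioi (a := (0:ℝ))]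
  exact h3.union h2

lemma fd_dom_int (g : ℝ → ℝ) (hg : Measurable g) (c : ℝ) (hc : 0 ≤ c)
    (h : ∀ t, |g t| ≤ (2 + |t|) ^ c) : Integrable (fun t => g t * fdKer t) := by
  refine (fd_exp_int c hc).mono' (hg.mul fdKer_cont.measurable).aestronglyMeasurable ?_
  filter_upwards with t
  rw [norm_mul, Real.norm_eq_abs, Real.norm_of_nonneg (fdKer_pos t).le]
  exact mul_le_mul (h t) (fdKer_le_abs t) (fdKer_pos t).le (by positivity)

lemma fdKer_int : Integrable fdKer := by
  have := fd_dom_int (fun _ => 1) measurable_const 0 le_rfl (by simp)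
  simpa using this

lemma fdKer_int1 : Integrable (fun t => t * fdKer t) := by
  refine fd_dom_int (fun t => t) measurable_id 1 zero_le_one (fun t => ?_)
  rw [Real.rpow_one]; linarith

lemma fdKer_integral : ∫ t, fdKer t = 1 := by
  rw [integral_of_hasDerivAt_of_tendsto fdKer_hasDerivAt fdKer_int (m := -1) (n := 0)]
  · norm_num
  · have : Tendsto (fun t => -(1 + Real.exp t)⁻¹) atBot (𝓝 (-(1 + 0)⁻¹)) :=
      ((Real.tendsto_exp_atBot.const_add 1).inv₀ (by norm_num)).neg
    simpa using this
  · have : Tendsto (fun t => -(1 + Real.exp t)⁻¹) atTop (𝓝 (-0)) :=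
      ((tendsto_atTop_add_const_left atTop 1 Real.tendsto_exp_atTop).inv_tendsto_atTop).neg
    simpa using this

lemma fdKer_integral1 : ∫ t, t * fdKer t = 0 := by
  have h := integral_neg_eq_self (fun t => t * fdKer t) (volume : Measure ℝ)
  simp only [fdKer_neg, neg_mul, integral_neg] at h
  linarith

lemma fd_gamma_int (a : ℝ) (ha : 0 ≤ a) (K : ℝ) :
    Integrable (fun x : ℝ => x ^ a * (K * Real.exp (-x))) (volume.restrict (Ioi 0)) := by
  have h := (Real.GammaIntegral_convergent (s := a + 1) (by linarith)).const_mul K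
  refine h.congr ?_
  filter_upwards with x
  simp only [add_sub_cancel_right]
  ring

lemma fermi_integrable (a : ℝ) (ha : 0 ≤ a) (w : ℝ) :
    Integrable (fun x : ℝ => x ^ a / (1 + Real.exp (x - w))) (volume.restrict (Ioi 0)) := by
  refine (fd_gamma_int a ha (Real.exp w)).mono' ?_ ?_
  · exact Measurable.aestronglyMeasurable (by fun_prop)
  · filter_upwards [ae_restrict_mem measurableSet_Ioi] with x hx
    have hx : 0 < x := hx
    rw [Real.norm_of_nonneg (by positivity), ← Real.exp_add, div_eq_mul_inv]
    gcongr
    rw [show w + -x = -(x - w) by ring, Real.exp_neg]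
    gcongr
    linarith

lemma fermi_deriv (a : ℝ) (ha : 0 ≤ a) (w : ℝ) :
    Integrable (fun x : ℝ => x ^ a * fdKer (x - w)) (volume.restrict (Ioi 0)) ∧
    HasDerivAt (fermi a) (fdM a w) w := by
  refine hasDerivAt_integral_of_dominated_loc_of_deriv_le (μ := volume.restrict (Ioi 0))
    (F := fun w x => x ^ a / (1 + Real.exp (x - w)))
    (F' := fun w x => x ^ a * fdKer (x - w))
    (bound := fun x : ℝ => x ^ a * (Real.exp (w + 1) * Real.exp (-x)))
    (Metric.ball_mem_nhds w one_pos) ?_ (fermi_integrable a ha w) ?_ ?_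
    (fd_gamma_int a ha _) ?_
  · filter_upwards with v
    exact (fermi_integrable a ha v).aestronglyMeasurable
  · apply Measurable.aestronglyMeasurable
    have := fdKer_cont.measurable
    fun_prop
  · filter_upwards [ae_restrict_mem measurableSet_Ioi] with x hx v hv
    have hx : 0 < x := hx
    have := fdKer_pos (x - v)
    rw [Real.norm_of_nonneg (by positivity)]
    gcongr
    refine (fdKer_le _).trans ?_
    rw [← Real.exp_add]
    apply Real.exp_le_exp.2
    rw [Metric.mem_ball, Real.dist_eq, abs_lt] at hv
    linarith [hv.2]
  · filter_upwards with x v hv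
    have h1 := (fdKer_hasDerivAt (x - v)).scomp v ((hasDerivAt_id v).const_sub x)
    have h2 := h1.fun_neg.const_mul (x ^ a)
    convert! h2 using 1
    · ext u; simp [div_eq_mul_inv]
    · simp

lemma fdM_pos (a : ℝ) (ha : 0 ≤ a) (w : ℝ) : 0 < fdM a w := by
  unfold fdM
  rw [setIntegral_pos_iff_support_of_nonneg_ae]
  · have : Ioi (0:ℝ) ⊆ support (fun x : ℝ => x ^ a * fdKer (x - w)) ∩ Ioi 0 := by
      intro x hx
      refine ⟨?_, hx⟩
      have hx : 0 < x := hx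
      have := fdKer_pos (x - w)
      rw [mem_support]
      positivity
    refine lt_of_lt_of_le ?_ (measure_mono this)
    simp
  · filter_upwards [ae_restrict_mem measurableSet_Ioi] with x hx
    have hx : 0 < x := hx
    have := fdKer_pos (x - w)
    show (0:ℝ) ≤ _
    positivity
  · exact (fermi_deriv a ha w).1

lemma fdM_eq (a : ℝ) (ha : 0 ≤ a) (w : ℝ) : fdM (a + 1) w = (a + 1) * fermi a w := by
  have hint := fermi_integrable a ha w
  have h := integral_Ioi_mul_deriv_eq_deriv_mul (a := (0:ℝ)) (a' := 0) (b' := 0)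
    (u := fun x : ℝ => x ^ (a + 1)) (u' := fun x => (a + 1) * x ^ a)
    (v := fun x => -(1 + Real.exp (x - w))⁻¹) (v' := fun x => fdKer (x - w))
    (fun x hx => by
      have := Real.hasDerivAt_rpow_const (x := x) (p := a + 1) (Or.inl (ne_of_gt hx))
      simpa using this)
    (fun x hx => by
      have h1 := (fdKer_hasDerivAt (x - w)).scomp x ((hasDerivAt_id x).sub_const w)
      convert! h1 using 1
      simp)
    (fermi_deriv (a + 1) (by linarith) w).1
    (by
      refine (hint.const_mul (-(a + 1))).congr ?_
      filter_upwards with x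
      simp only [Pi.mul_apply, div_eq_mul_inv]
      ring)
    (by
      have hc : Continuous (fun x : ℝ => x ^ (a + 1) * -(1 + Real.exp (x - w))⁻¹) := by
        refine Continuous.mul (Real.continuous_rpow_const (by linarith)) ?_
        refine Continuous.neg (Continuous.inv₀ (by fun_prop) (fun x => by positivity))
      have := hc.tendsto 0
      rw [Real.zero_rpow (by linarith), zero_mul] at this
      exact this.mono_left nhdsWithin_le_nhds)
    (by
      have h1 := (tendsto_rpow_mul_exp_neg_mul_atTop_nhds_zero (a + 1) 1 one_pos).const_mul
        (Real.exp w)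
      rw [mul_zero] at h1
      refine squeeze_zero_norm' ?_ h1
      filter_upwards [eventually_gt_atTop 0] with x hx
      simp only [Pi.mul_apply, norm_mul, norm_neg]
      rw [Real.norm_of_nonneg (by positivity), Real.norm_of_nonneg (by positivity),
        mul_left_comm, ← Real.exp_add]
      gcongr
      rw [show w + -1 * x = -(x - w) by ring, Real.exp_neg]
      gcongr
      linarith)
  unfold fdM
  rw [h]
  unfold fermi
  rw [← integral_const_mul, sub_zero, zero_sub, ← integral_neg]
  congr 1
  ext x
  ring

lemma fd_pointwise (b : ℝ) (hb : 0 ≤ b) :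
    ∃ C ≥ (0:ℝ), ∀ s > (0:ℝ), |s ^ b - 1 - b * (s - 1)| ≤ C * ((s - 1) ^ 2 * (1 + s) ^ b) := by
  -- derivative bound
  have hd : HasDerivAt (fun s : ℝ => s ^ (b - 1)) ((b - 1) * 1 ^ (b - 1 - 1)) 1 :=
    Real.hasDerivAt_rpow_const (Or.inl one_ne_zero)
  obtain ⟨K, hK⟩ := hd.isBigO_sub.bound
  obtain ⟨ε, hε, hball⟩ := Metric.eventually_nhds_iff_ball.1
    (hK.and (eventually_gt_nhds (zero_lt_one' ℝ)))
  have hK0 : ∀ y ∈ Metric.ball (1:ℝ) ε, ‖y ^ (b - 1) - 1‖ ≤ |K| * ‖y - 1‖ := by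
    intro y hy
    have := (hball y hy).1
    rw [Real.one_rpow] at this
    exact this.trans (by gcongr; exact le_abs_self K)
  refine ⟨b * |K| + 2 / ε ^ 2 + b / ε, by positivity, fun s hs => ?_⟩
  have h1 : 1 ≤ (1 + s) ^ b := Real.one_le_rpow (by linarith) hb
  rcases lt_or_ge |s - 1| ε with h | h
  · have key : ‖(s ^ b - b * s) - ((1:ℝ) ^ b - b * 1)‖ ≤ (b * |K| * |s - 1|) * ‖s - 1‖ := by
      have hsub : ∀ y ∈ segment ℝ 1 s, |y - 1| ≤ |s - 1| := by
        intro y hy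
        rw [segment_eq_uIcc] at hy
        have := abs_sub_left_of_mem_uIcc hy
        exact this
      refine Convex.norm_image_sub_le_of_norm_hasDerivWithin_le (s := segment ℝ 1 s)
        (f := fun y : ℝ => y ^ b - b * y) (f' := fun y => b * y ^ (b - 1) - b * 1) ?_ ?_
        (convex_segment _ _) (left_mem_segment _ _ _) (right_mem_segment _ _ _)
      · intro y hy
        have hy' := hball y (by rw [Metric.mem_ball, Real.dist_eq]; exact (hsub y hy).trans_lt h)
        exact ((Real.hasDerivAt_rpow_const (Or.inl hy'.2.ne')).sub
          ((hasDerivAt_id y).const_mul b)).hasDerivWithinAt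
      · intro y hy
        have hy' := hK0 y (by rw [Metric.mem_ball, Real.dist_eq]; exact (hsub y hy).trans_lt h)
        rw [← mul_sub, norm_mul, Real.norm_of_nonneg hb, mul_assoc]
        gcongr
        refine hy'.trans ?_
        gcongr
        exact hsub y hy
    rw [Real.one_rpow, Real.norm_eq_abs, Real.norm_eq_abs, mul_assoc, ← sq, sq_abs] at key
    rw [show s ^ b - 1 - b * (s - 1) = s ^ b - b * s - (1 - b * 1) by ring]
    refine key.trans ?_
    rw [mul_comm ((s-1)^2), ← mul_assoc]
    refine mul_le_mul_of_nonneg_right ?_ (sq_nonneg _)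
    calc b * |K| ≤ (b * |K| + 2 / ε ^ 2 + b / ε) * 1 := by
          rw [mul_one, add_assoc]; exact le_add_of_nonneg_right (by positivity)
      _ ≤ _ := by gcongr
  · have h2 : s ^ b ≤ (1 + s) ^ b := Real.rpow_le_rpow hs.le (by linarith) hb
    have h3 : 0 ≤ s ^ b := by positivity
    set A := (1 + s) ^ b
    set r := |s - 1| with hr
    have hr2 : (s - 1) ^ 2 = r ^ 2 := (sq_abs _).symm
    have hA : |s ^ b - 1 - b * (s - 1)| ≤ 2 * A + b * r := by
      calc _ ≤ |s ^ b - 1| + |b * (s - 1)| := abs_sub _ _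
        _ ≤ _ := by
          rw [abs_mul, abs_of_nonneg hb]
          gcongr
          rw [abs_le]; constructor <;> linarith
    refine hA.trans ?_
    rw [hr2]
    have e1 : 2 * A ≤ 2 / ε ^ 2 * (r ^ 2 * A) := by
      have : ε ^ 2 ≤ r ^ 2 := by gcongr
      rw [div_mul_eq_mul_div, le_div_iff₀ (by positivity)]
      nlinarith
    have e2 : b * r ≤ b / ε * (r ^ 2 * A) := by
      rw [div_mul_eq_mul_div, le_div_iff₀ hε, mul_assoc]
      refine mul_le_mul_of_nonneg_left ?_ hb
      have hr0 : 0 ≤ r := abs_nonneg _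
      calc r * ε ≤ r * r := by gcongr
        _ = r ^ 2 * 1 := by ring
        _ ≤ _ := by gcongr
    have e3 : 0 ≤ b * |K| * (r ^ 2 * A) := by positivity
    linarith

lemma fdM_eq_whole (b w : ℝ) :
    fdM b w = ∫ t, (if 0 < t + w then (t + w) ^ b else 0) * fdKer t := by
  unfold fdM
  rw [← integral_indicator measurableSet_Ioi, ← integral_add_right_eq_self _ w]
  congr 1
  ext t
  simp only [indicator, mem_Ioi, add_sub_cancel_right, ite_mul, zero_mul]

lemma fd_whole_int (b : ℝ) (hb : 0 ≤ b) (w : ℝ) :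
    Integrable (fun t => (if 0 < t + w then (t + w) ^ b else 0) * fdKer t) := by
  have h := (((integrable_indicator_iff measurableSet_Ioi).2 (fermi_deriv b hb w).1)).comp_add_right w
  refine h.congr ?_
  filter_upwards with t
  simp only [indicator, mem_Ioi, add_sub_cancel_right, ite_mul, zero_mul]

lemma fdM_asymp (b : ℝ) (hb : 0 ≤ b) :
    ∃ C ≥ (0:ℝ), ∀ w ≥ (1:ℝ), |fdM b w - w ^ b| ≤ C * (w ^ b / w ^ 2) := by
  obtain ⟨C, hC, hpt⟩ := fd_pointwise b hb
  set J := ∫ t : ℝ, (2 + |t|) ^ (b + 2) * Real.exp (-|t|) with hJ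
  have hJ0 : 0 ≤ J := integral_nonneg (fun t => by positivity)
  refine ⟨(C + (1 + b)) * J, by positivity, fun w hw => ?_⟩
  have hw0 : 0 < w := by linarith
  have hwb : 0 < w ^ b := by positivity
  have e : fdM b w - w ^ b = ∫ t, ((if 0 < t + w then (t + w) ^ b else 0) * fdKer t
      - (w ^ b * fdKer t + w ^ b * (b / w) * (t * fdKer t))) := by
    have hsum : Integrable (fun t => w ^ b * fdKer t + w ^ b * (b / w) * (t * fdKer t)) :=
      (fdKer_int.const_mul _).add (fdKer_int1.const_mul _)
    rw [integral_sub (fd_whole_int b hb w) hsum,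
      integral_add (fdKer_int.const_mul _) (fdKer_int1.const_mul _),
      integral_const_mul, integral_const_mul, fdKer_integral, fdKer_integral1, fdM_eq_whole]
    ring
  rw [e, ← Real.norm_eq_abs]
  have e2 : (C + (1 + b)) * J * (w ^ b / w ^ 2)
      = ∫ t : ℝ, ((C + (1 + b)) * (w ^ b / w ^ 2)) *
          ((2 + |t|) ^ (b + 2) * Real.exp (-|t|)) := by
    rw [integral_const_mul]; ring
  rw [e2]
  refine norm_integral_le_of_norm_le ((fd_exp_int (b + 2) (by linarith)).const_mul _) ?_
  filter_upwards with t
  rw [show (if 0 < t + w then (t + w) ^ b else 0) * fdKer t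
      - (w ^ b * fdKer t + w ^ b * (b / w) * (t * fdKer t)) =
      ((if 0 < t + w then (t + w) ^ b else 0) - w ^ b - w ^ b * (b / w) * t) * fdKer t by ring,
    norm_mul, Real.norm_of_nonneg (fdKer_pos t).le, Real.norm_eq_abs, ← mul_assoc]
  refine mul_le_mul ?_ (fdKer_le_abs t) (fdKer_pos t).le (by positivity)
  have hpow : (2 + |t|) ^ (b + 2) = (2 + |t|) ^ b * (2 + |t|) ^ 2 := by
    rw [Real.rpow_add (by positivity)]
    norm_num
  have hone : 1 ≤ (2 + |t|) ^ b := Real.one_le_rpow (by linarith [abs_nonneg t]) hb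
  have ht2 : t ^ 2 ≤ (2 + |t|) ^ 2 := by
    rw [← sq_abs t]
    gcongr
    linarith
  rw [hpow]
  split_ifs with hs
  · have hsp : 0 < (t + w) / w := by positivity
    have h := hpt _ hsp
    have hs1 : (t + w) / w - 1 = t / w := by field_simp; ring
    have hle : 1 + (t + w) / w ≤ 2 + |t| := by
      have : t / w ≤ |t| := by
        rw [div_le_iff₀ hw0]
        nlinarith [le_abs_self t, abs_nonneg t]
      linarith
    have e3 : (t + w) ^ b - w ^ b - w ^ b * (b / w) * t =
        w ^ b * (((t + w) / w) ^ b - 1 - b * ((t + w) / w - 1)) := by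
      rw [hs1, Real.div_rpow hs.le hw0.le]
      field_simp
    rw [e3, abs_mul, abs_of_pos hwb]
    calc _ ≤ w ^ b * (C * (((t + w) / w - 1) ^ 2 * (1 + (t + w) / w) ^ b)) := by gcongr
      _ ≤ w ^ b * (C * (((t + w) / w - 1) ^ 2 * (2 + |t|) ^ b)) := by gcongr
      _ = C * (w ^ b / w ^ 2) * ((2 + |t|) ^ b * t ^ 2) := by
          rw [hs1]; field_simp
      _ ≤ _ := by
          gcongr
          linarith
  · have htw : w ≤ |t| := by
      rw [le_abs]; right; linarith
    have h1 : 1 ≤ |t| / w := by rwa [le_div_iff₀ hw0, one_mul]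
    have h4 : |0 - w ^ b - w ^ b * (b / w) * t| ≤ w ^ b + w ^ b * (b * (|t| / w)) := by
      calc _ ≤ |0 - w ^ b| + |w ^ b * (b / w) * t| := abs_sub _ _
        _ = _ := by
          rw [zero_sub, abs_neg, abs_of_pos hwb, abs_mul, abs_of_nonneg (by positivity)]
          ring
    refine h4.trans ?_
    calc w ^ b + w ^ b * (b * (|t| / w)) ≤ w ^ b * (|t| / w) ^ 2 + w ^ b * (b * (|t| / w) ^ 2) := by
          have h5 : 1 ≤ (|t| / w) ^ 2 := one_le_pow₀ h1
          have h6 : |t| / w ≤ (|t| / w) ^ 2 := by nlinarith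
          gcongr
          nlinarith
      _ = (1 + b) * (w ^ b / w ^ 2) * (1 * |t| ^ 2) := by field_simp
      _ ≤ _ := by
          rw [sq_abs]
          exact mul_le_mul (mul_le_mul_of_nonneg_right (by linarith) (by positivity))
            (by gcongr) (by positivity) (by positivity)

/-- Key comparison. -/
lemma fd_compare (b : ℝ) (hb : 1 ≤ b) :
    ∃ C ≥ (0:ℝ), ∃ w₀ ≥ (1:ℝ), ∀ w ≥ w₀,
      |fdM b w / fdM (b - 1) w - fdM b w ^ (1 / b)| ≤ C * fdM b w ^ (-(1 / b)) ∧
      w / 2 ≤ fdM b w := by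
  obtain ⟨C1, hC1, h1⟩ := fdM_asymp b (by linarith)
  obtain ⟨C2, hC2, h2⟩ := fdM_asymp (b - 1) (by linarith)
  have hb0 : 0 < b := by linarith
  refine ⟨(C1 + 2 * (C1 + C2)) * 2, by positivity, 1 + 2 * C1 + 2 * C2, by linarith, fun w hw => ?_⟩
  have hw1 : 1 ≤ w := by linarith
  have hw0 : 0 < w := by linarith
  have hww : w ≤ w ^ 2 := by nlinarith
  have hwb : 0 < w ^ b := by positivity
  have hwb1 : 0 < w ^ (b - 1) := by positivity
  have hsplit : w ^ b = w ^ (b - 1) * w := by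
    rw [Real.rpow_sub_one hw0.ne']; field_simp
  specialize h1 w hw1
  specialize h2 w hw1
  obtain ⟨p, hp⟩ : ∃ p, fdM b w = w ^ b * (1 + p) :=
    ⟨fdM b w / w ^ b - 1, by field_simp; ring⟩
  obtain ⟨q, hq⟩ : ∃ q, fdM (b - 1) w = w ^ (b - 1) * (1 + q) :=
    ⟨fdM (b - 1) w / w ^ (b - 1) - 1, by field_simp; ring⟩
  have hp1 : |p| ≤ C1 / w ^ 2 := by
    rw [hp, show w ^ b * (1 + p) - w ^ b = w ^ b * p by ring, abs_mul, abs_of_pos hwb] at h1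
    refine le_of_mul_le_mul_left (h1.trans_eq ?_) hwb
    ring
  have hq1 : |q| ≤ C2 / w ^ 2 := by
    rw [hq, show w ^ (b-1) * (1 + q) - w ^ (b-1) = w ^ (b-1) * q by ring, abs_mul,
      abs_of_pos hwb1] at h2
    refine le_of_mul_le_mul_left (h2.trans_eq ?_) hwb1
    ring
  have hp2 : |p| ≤ 1 / 2 := hp1.trans (by rw [div_le_iff₀ (by positivity)]; linarith)
  have hq2 : |q| ≤ 1 / 2 := hq1.trans (by rw [div_le_iff₀ (by positivity)]; linarith)
  obtain ⟨hp3, hp4⟩ := abs_le.1 hp2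
  obtain ⟨hq3, hq4⟩ := abs_le.1 hq2
  have hroot : fdM b w ^ (1 / b) = w * (1 + p) ^ (1 / b) := by
    rw [hp, Real.mul_rpow hwb.le (by linarith), ← Real.rpow_mul hw0.le, mul_one_div_cancel hb0.ne',
      Real.rpow_one]
  have hib : 1 / b ≤ 1 := by rw [div_le_iff₀ hb0]; linarith
  have hib0 : 0 ≤ 1 / b := by positivity
  have hr : |(1 + p) ^ (1 / b) - 1| ≤ |p| := by
    rcases le_total 0 p with h | h
    · have a1 := Real.one_le_rpow (x := 1 + p) (z := 1 / b) (by linarith) hib0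
      have a2 := Real.rpow_le_rpow_of_exponent_le (x := 1 + p) (by linarith) hib
      rw [Real.rpow_one] at a2
      rw [abs_of_nonneg h, abs_le]; constructor <;> linarith
    · have a1 := Real.rpow_le_one (x := 1 + p) (z := 1 / b) (by linarith) (by linarith) hib0
      have a2 := Real.rpow_le_rpow_of_exponent_ge (x := 1 + p) (by linarith) (by linarith) hib
      rw [Real.rpow_one] at a2
      rw [abs_of_nonpos h, abs_le]; constructor <;> linarith
  have hrat : fdM b w / fdM (b - 1) w = w * ((1 + p) / (1 + q)) := by
    rw [hp, hq, hsplit]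
    have : 1 + q ≠ 0 := by linarith
    field_simp
  have hr2 : |(1 + p) / (1 + q) - 1| ≤ 2 * (|p| + |q|) := by
    have hq0 : 0 < 1 + q := by linarith
    rw [show (1 + p) / (1 + q) - 1 = (p - q) / (1 + q) by field_simp; ring, abs_div,
      abs_of_pos hq0, div_le_iff₀ hq0]
    have := abs_sub p q
    nlinarith [abs_nonneg p, abs_nonneg q]
  constructor
  · have hL : |fdM b w / fdM (b - 1) w - fdM b w ^ (1 / b)| ≤ (C1 + 2 * (C1 + C2)) * w⁻¹ := by
      rw [hrat, hroot, ← mul_sub, abs_mul, abs_of_pos hw0]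
      calc _ ≤ w * (|(1 + p) / (1 + q) - 1| + |(1 + p) ^ (1 / b) - 1|) := by
            gcongr
            rw [show (1 + p) / (1 + q) - (1 + p) ^ (1 / b) =
              ((1 + p) / (1 + q) - 1) - ((1 + p) ^ (1 / b) - 1) by ring]
            exact abs_sub _ _
        _ ≤ w * (2 * (C1 / w ^ 2 + C2 / w ^ 2) + C1 / w ^ 2) := by
            gcongr
            · exact hr2.trans (by gcongr)
            · exact hr.trans hp1
        _ = _ := by field_simp; ring
    refine hL.trans ?_
    rw [mul_assoc]
    gcongr
    have hMpos : 0 < fdM b w := by rw [hp]; exact mul_pos hwb (by linarith)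
    rw [Real.rpow_neg hMpos.le, hroot]
    have hx : (1 + p) ^ (1 / b) ≤ 2 := by
      have := (abs_le.1 hr).2
      linarith
    have hx0 : 0 < (1 + p) ^ (1 / b) := Real.rpow_pos_of_pos (by linarith) _
    rw [mul_inv, ← mul_assoc, mul_comm 2, mul_assoc]
    refine le_mul_of_one_le_right (by positivity) ?_
    rw [← div_eq_mul_inv, le_div_iff₀ hx0]
    linarith
  · rw [hp]
    have : w ≤ w ^ b := by
      have := Real.rpow_le_rpow_of_exponent_le hw1 hb
      rwa [Real.rpow_one] at this
    nlinarith

theorem fermiDiracPressure_deriv_asymptotics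
    (d : ℕ) (hd : 2 ≤ d) (μ : ℝ) (hμ : 0 < μ) :
    ∃ C > (0:ℝ), ∃ z₀ > (0:ℝ), ∀ z ≥ z₀,
      |deriv (fermiDiracPressure d μ) z -
        (2 / (d : ℝ)) * ((d : ℝ) * z / μ) ^ (2 / (d : ℝ))| ≤
      C * z ^ (-(2 / (d : ℝ))) := by
  set b : ℝ := (d : ℝ) / 2 with hbdef
  have hd2 : (2:ℝ) ≤ d := by exact_mod_cast hd
  have hd0 : (0:ℝ) < d := by linarith
  have hb : 1 ≤ b := by rw [hbdef]; linarith
  have hb0 : 0 < b := by linarith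
  have hba : 0 ≤ b - 1 := by linarith
  have h2d : 2 / (d:ℝ) = 1 / b := by rw [hbdef]; field_simp
  obtain ⟨C, hC, w₀, hw₀, hcmp⟩ := fd_compare b hb
  set f := fermi (b - 1) with hf
  set g := Function.invFun f with hg
  have hMf : ∀ w, fdM b w = b * f w := by
    intro w
    have := fdM_eq (b - 1) hba w
    rwa [sub_add_cancel] at this
  have hfd : ∀ w, HasDerivAt f (fdM (b - 1) w) w := fun w => (fermi_deriv (b - 1) hba w).2
  have hfmono : StrictMono f :=
    strictMono_of_hasDerivAt_pos hfd (fun w => fdM_pos _ hba w)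
  have hfcont : Continuous f := continuous_iff_continuousAt.2 (fun w => (hfd w).continuousAt)
  have hgf : ∀ w, g (f w) = w := Function.leftInverse_invFun hfmono.injective
  have hsurj : ∀ y > f w₀, ∃ w > w₀, f w = y := by
    intro y hy
    have hbig : y ≤ f (max w₀ (2 * b * y)) := by
      have h1 := (hcmp _ (le_max_left w₀ (2 * b * y))).2
      rw [hMf] at h1
      have h2 := le_max_right w₀ (2 * b * y)
      have : b * y ≤ b * f (max w₀ (2 * b * y)) := by linarith
      exact le_of_mul_le_mul_left this hb0
    obtain ⟨w, hw, hwy⟩ := intermediate_value_Icc (le_max_left w₀ (2 * b * y))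
      hfcont.continuousOn ⟨hy.le, hbig⟩
    refine ⟨w, ?_, hwy⟩
    rw [← hwy] at hy
    exact hfmono.lt_iff_lt.1 hy
  have hfg : ∀ y > f w₀, f (g y) = y := by
    intro y hy
    obtain ⟨w, -, rfl⟩ := hsurj y hy
    rw [hgf]
  have hgd : ∀ w > w₀, HasDerivAt g (fdM (b - 1) w)⁻¹ (f w) := by
    intro w hw
    have hlt : f w₀ < f w := hfmono hw
    refine HasDerivAt.of_local_left_inverse (f := f) ?_ ?_ (fdM_pos _ hba w).ne' ?_
    · refine StrictMonoOn.continuousAt_of_image_mem_nhds (s := Ioi (f w₀)) ?_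
        (Ioi_mem_nhds hlt) ?_
      · intro y hy y' hy' hyy
        rw [← hfmono.lt_iff_lt, hfg y hy, hfg y' hy']
        exact hyy
      · rw [hgf]
        refine mem_of_superset (Ioi_mem_nhds hw) (fun v hv => ⟨f v, hfmono hv, hgf v⟩)
    · rw [hgf]; exact hfd w
    · filter_upwards [Ioi_mem_nhds hlt] with y hy using hfg y hy
  have hfw0 : 0 < f w₀ := by
    have := (hcmp w₀ le_rfl).2
    rw [hMf] at this
    by_contra hcon
    nlinarith
  refine ⟨(1 / b) * C * (d / μ) ^ (-(1 / b)) + 1, by positivity, μ * f w₀, by positivity,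
    fun z hz => ?_⟩
  have hz0 : 0 < z := lt_of_lt_of_le (by positivity) hz
  obtain ⟨w, hw, hwz⟩ := hsurj (2 * z / μ) (by
    rw [gt_iff_lt, lt_div_iff₀ hμ]
    nlinarith)
  have hM : fdM b w = d * z / μ := by
    rw [hMf, hwz, hbdef]; ring
  have hder : HasDerivAt (fermiDiracPressure d μ)
      ((μ / d) * (fdM b w * ((fdM (b - 1) w)⁻¹ * (2 / μ)))) z := by
    have h1 : HasDerivAt (fun z : ℝ => 2 * z / μ) (2 / μ) z := by
      have := ((hasDerivAt_id z).const_mul 2).div_const μ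
      simpa using this
    have h2 := hgd w hw
    rw [hwz] at h2
    have h3 : HasDerivAt (fun z => g (2 * z / μ)) ((fdM (b - 1) w)⁻¹ * (2 / μ)) z :=
      HasDerivAt.comp (h₂ := g) z h2 h1
    have hgz : g (2 * z / μ) = w := by rw [← hwz, hgf]
    have h4 := (fermi_deriv b hb0.le w).2
    rw [← hgz] at h4
    have h5 : HasDerivAt (fun z => fermi b (g (2 * z / μ)))
        (fdM b (g (2 * z / μ)) * ((fdM (b - 1) w)⁻¹ * (2 / μ))) z :=
      HasDerivAt.comp (h₂ := fermi b) z h4 h3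
    rw [hgz] at h5
    exact h5.const_mul (μ / d)
  rw [hder.deriv, h2d]
  have e1 : (μ / d) * (fdM b w * ((fdM (b - 1) w)⁻¹ * (2 / μ))) =
      (1 / b) * (fdM b w / fdM (b - 1) w) := by
    have := (fdM_pos _ hba w).ne'
    rw [← h2d]
    field_simp
  rw [e1, ← mul_sub, abs_mul, abs_of_pos (by positivity : 0 < 1 / b)]
  have h6 := (hcmp w hw.le).1
  rw [hM] at h6 ⊢
  have e2 : (d * z / μ : ℝ) ^ (-(1 / b)) = (d / μ) ^ (-(1 / b)) * z ^ (-(1 / b)) := by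
    rw [← Real.mul_rpow (by positivity) hz0.le]
    congr 1
    ring
  rw [e2] at h6
  have hzp : 0 < z ^ (-(1 / b)) := by positivity
  calc _ ≤ (1 / b) * (C * ((d / μ) ^ (-(1 / b)) * z ^ (-(1 / b)))) := by gcongr
    _ ≤ _ := by nlinarith
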